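/- Let L(x,y) = (x² + y²)/2 and let η > 0 with η ≠ 1. The implicit twisted gradient descent step, i.e. the solution of x⁺ = x − η x⁺ and y⁺ = y + η y⁺, is x⁺ = x/(1+η), y⁺ = y/(1−η). Moreover, if η > 2, then both |1/(1+η)| < 1 and |1/(1−η)| < 1, so iterating the step from any initial point produces a sequence converging to (0,0) — a stationary point of L that is NOT a min-max saddle point (it is a minimum in y rather than a maximum). -/

import Mathlib

/-- A real sequence obtained by repeatedly dividing by `c` tends to `0` when `|1 / c| < 1`. -/
theorem tendsto_zero_of_succ_eq_div {c : ℝ} (hc : |1 / c| < 1) {u : ℕ → ℝ}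
    (hu : ∀ n, u (n + 1) = u n / c) : Filter.Tendsto u Filter.atTop (nhds 0) := by
  have h_closed : ∀ n, u n = u 0 * (1 / c) ^ n := by
    intro n
    induction n with
    | zero => simp
    | succ n ih => rw [hu, ih, pow_succ]; ring
  rw [funext h_closed]
  simpa using (tendsto_pow_atTop_nhds_zero_of_abs_lt_one hc).const_mul (u 0)


/-- For `L(x,y) = (x² + y²)/2` with `η > 0`, `η ≠ 1`, the implicit twisted gradient
descent step is the unique solution of `x⁺ = x − η x⁺`, `y⁺ = y + η y⁺`, namely
`(x/(1+η), y/(1−η))`; for `η > 2` both multipliers have absolute value `< 1`, so the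
iterates converge to `(0,0)`, a stationary point that is not a min-max saddle point. -/
theorem implicit_twisted_gd_x2_plus_y2
    (η : ℝ) (hη : 0 < η) (hη1 : η ≠ 1) :
    (∀ a b : ℝ, ∃! p : ℝ × ℝ, p.1 = a - η * p.1 ∧ p.2 = b + η * p.2) ∧
    (∀ a b : ℝ, (a / (1 + η) : ℝ) = a - η * (a / (1 + η)) ∧
                (b / (1 - η) : ℝ) = b + η * (b / (1 - η))) ∧
    (2 < η →
      |1 / (1 + η)| < 1 ∧ |1 / (1 - η)| < 1 ∧
      ∀ x y : ℕ → ℝ,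
        (∀ n, x (n + 1) = x n / (1 + η)) →
        (∀ n, y (n + 1) = y n / (1 - η)) →
        Filter.Tendsto (fun n => (x n, y n)) Filter.atTop (nhds (0, 0))) := by
  have hx : 1 + η ≠ 0 := by positivity
  have hy : 1 - η ≠ 0 := sub_ne_zero.mpr hη1.symm
  have step : ∀ a b : ℝ, a / (1 + η) = a - η * (a / (1 + η)) ∧
      b / (1 - η) = b + η * (b / (1 - η)) := by
    intro a b
    constructor
    · field_simp
      ring
    · field_simp
      ring
  refine ⟨fun a b => ⟨(a / (1 + η), b / (1 - η)), step a b, ?_⟩, step, fun h2 => ?_⟩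
  · rintro ⟨p, q⟩ ⟨hp, hq⟩
    simp only at hp hq
    rw [Prod.mk.injEq, eq_div_iff hx, eq_div_iff hy]
    constructor <;> linarith
  · have h₁ : |1 / (1 + η)| < 1 := by
      rw [abs_div, abs_one, div_lt_one (abs_pos.mpr hx), lt_abs]
      left
      linarith
    have h₂ : |1 / (1 - η)| < 1 := by
      rw [abs_div, abs_one, div_lt_one (abs_pos.mpr hy), lt_abs]
      right
      linarith
    exact ⟨h₁, h₂, fun x y hxs hys =>
      (tendsto_zero_of_succ_eq_div h₁ hxs).prodMk_nhds (tendsto_zero_of_succ_eq_div h₂ hys)⟩
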